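/- Let d ∈ ℝ and let B be a positive definite real 2×2 matrix with B · B = A_d⁻¹. Then for every μ ∈ ℝ, det(B · σ₁ · B − μ·I₂) = 0 if and only if μ ≠ 0 and (1/μ)² + Δ⁻¹·(1/μ) + 1/4 − Δ² = 0. (That is, the eigenvalues of |X_d|^{-1/2}·σ₁·|X_d|^{-1/2} are exactly the reciprocals of the roots of p_d.) -/

import Mathlib

open Matrix

/-- `Δ = √(4d² + 1)`. -/
noncomputable def Δ (d : ℝ) : ℝ := Real.sqrt (4 * d ^ 2 + 1)

/-- The symmetric matrix `X_d = !![2d − 1/2, 1; 1, −2d − 1/2]`. -/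
noncomputable def Xmat (d : ℝ) : Matrix (Fin 2) (Fin 2) ℝ := !![2 * d - 1/2, 1; 1, -2 * d - 1/2]

/-- The Pauli matrix `σ₁ = !![0, 1; 1, 0]`. -/
noncomputable def sigma1 : Matrix (Fin 2) (Fin 2) ℝ := !![0, 1; 1, 0]

/-- `A_d = (2Δ)⁻¹ • ((2Δ² − 1/2) • I₂ − X_d)`, the candidate for `|X_d|`. -/
noncomputable def Amat (d : ℝ) : Matrix (Fin 2) (Fin 2) ℝ :=
  (2 * Δ d)⁻¹ • ((2 * (Δ d) ^ 2 - 1/2) • (1 : Matrix (Fin 2) (Fin 2) ℝ) - Xmat d)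

theorem Delta_pos (d : ℝ) : 0 < Δ d := Real.sqrt_pos.mpr (by positivity)

theorem Delta_sq (d : ℝ) : Δ d ^ 2 = 4 * d ^ 2 + 1 := Real.sq_sqrt (by positivity)

theorem Amat_eq (d : ℝ) :
    Amat d = (2 * Δ d)⁻¹ • !![2 * Δ d ^ 2 - 2 * d, -1; -1, 2 * Δ d ^ 2 + 2 * d] := by
  unfold Amat Xmat
  congr 1
  ext i j
  fin_cases i <;> fin_cases j <;> simp

theorem det_Amat (d : ℝ) : (Amat d).det = Δ d ^ 2 - 1 / 4 := by
  have hΔ := (Delta_pos d).ne'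
  rw [Amat_eq, det_smul, det_fin_two_of, Fintype.card_fin]
  field_simp
  linear_combination 4 * Delta_sq d

theorem det_Amat_pos (d : ℝ) : 0 < (Amat d).det := by
  rw [det_Amat, Delta_sq]
  nlinarith [sq_nonneg d]

theorem det_mul_sigma1_mul_sub_smul_one (B : Matrix (Fin 2) (Fin 2) ℝ) (μ : ℝ) :
    (B * sigma1 * B - μ • (1 : Matrix (Fin 2) (Fin 2) ℝ)).det =
      μ ^ 2 - μ * ((B * B) 0 1 + (B * B) 1 0) - (B * B).det := by
  simp only [sigma1, det_fin_two, Matrix.sub_apply, Matrix.smul_apply, mul_apply, Fin.sum_univ_two]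
  simp
  ring

theorem Amat_inv_offDiag (d : ℝ) :
    (Amat d)⁻¹ 0 1 + (Amat d)⁻¹ 1 0 = (Amat d).det⁻¹ * (Δ d)⁻¹ := by
  rw [inv_def, Ring.inverse_eq_inv', adjugate_fin_two]
  simp only [Amat_eq, Matrix.smul_apply, of_apply, cons_val', cons_val_zero, cons_val_one,
    cons_val_fin_one, smul_eq_mul]
  ring

/-- If `B` is a positive definite square root of `A_d⁻¹ = |X_d|⁻¹`, then the eigenvalues of
`B·σ₁·B = |X_d|^{-1/2}·σ₁·|X_d|^{-1/2}` are exactly the reciprocals of the roots of `p_d`. -/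
theorem eigenvalues_B_sigma1_B (d : ℝ) (B : Matrix (Fin 2) (Fin 2) ℝ)
    (hB : B.PosDef) (hBB : B * B = (Amat d)⁻¹) (μ : ℝ) :
    (B * sigma1 * B - μ • (1 : Matrix (Fin 2) (Fin 2) ℝ)).det = 0 ↔
      μ ≠ 0 ∧ (1/μ) ^ 2 + (Δ d)⁻¹ * (1/μ) + 1/4 - (Δ d) ^ 2 = 0 := by
  have hA := (det_Amat_pos d).ne'
  have hΔ := (Delta_pos d).ne'
  rw [det_mul_sigma1_mul_sub_smul_one, hBB, Amat_inv_offDiag, det_nonsing_inv,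
    Ring.inverse_eq_inv']
  have hp : (1 / μ) ^ 2 + (Δ d)⁻¹ * (1 / μ) + 1 / 4 - Δ d ^ 2 =
      (1 / μ) ^ 2 + (Δ d)⁻¹ * (1 / μ) - (Amat d).det := by
    rw [det_Amat]; ring
  rw [hp]
  generalize (Amat d).det = a at hA
  rcases eq_or_ne μ 0 with rfl | hμ
  · simp [hA]
  · have key : μ ^ 2 - μ * (a⁻¹ * (Δ d)⁻¹) - a⁻¹ =
        -(μ ^ 2 * a⁻¹) * ((1 / μ) ^ 2 + (Δ d)⁻¹ * (1 / μ) - a) := by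
      field_simp
      ring
    rw [key, mul_eq_zero, or_iff_right (by simp [hμ, hA])]
    simp [hμ]
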